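/- Let n ≥ 1, let λ₁, …, λₙ be positive reals, and let P > 0. Then there exists a unique μ > 0 such that ∑_{s=1}^n max(0, 1/μ − 1/λ_s) = P. -/

import Mathlib

lemma water_strict {n : ℕ} (c : Fin n → ℝ) (a b : ℝ) (hab : a < b)
    (hpos : 0 < ∑ s, max 0 (a - c s)) :
    ∑ s, max 0 (a - c s) < ∑ s, max 0 (b - c s) := by
  obtain ⟨s, hs, h⟩ : ∃ s ∈ Finset.univ, 0 < max 0 (a - c s) := by
    by_contra! h
    exact absurd (Finset.sum_nonpos h) (not_le.mpr hpos)
  apply Finset.sum_lt_sum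
  · intro i _
    exact max_le_max le_rfl (by linarith)
  · refine ⟨s, hs, ?_⟩
    have h1 : 0 < a - c s := by simpa using h
    rw [max_eq_right h1.le]
    exact lt_of_lt_of_le (by linarith) (le_max_right _ _)

/-- Existence and uniqueness of the water level: for positive eigenvalues `λ_s` and a
total power budget `P > 0` there is a unique `μ > 0` with
`∑ max(0, 1/μ − 1/λ_s) = P`. -/
theorem stmt_10 (n : ℕ) (hn : 1 ≤ n) (lam : Fin n → ℝ) (hlam : ∀ s, 0 < lam s)
    (P : ℝ) (hP : 0 < P) :
    ∃! μ : ℝ, 0 < μ ∧ ∑ s, max 0 (1 / μ - 1 / lam s) = P := by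
  have hc : ∀ s, 0 < 1 / lam s := fun s => one_div_pos.mpr (hlam s)
  let F : ℝ → ℝ := fun t => ∑ s, max 0 (t - 1 / lam s)
  have hF : Continuous F := by
    refine continuous_finsetSum _ fun s _ => ?_
    exact continuous_const.max (continuous_id.sub continuous_const)
  have h0 : F 0 = 0 := by
    refine Finset.sum_eq_zero fun s _ => max_eq_left ?_
    linarith [hc s]
  let i : Fin n := ⟨0, hn⟩
  have h1 : P ≤ F (P + 1 / lam i) := by
    have := Finset.single_le_sum (f := fun s => max 0 (P + 1 / lam i - 1 / lam s))
      (fun s _ => le_max_left _ _) (Finset.mem_univ i)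
    refine le_trans ?_ this
    exact le_trans (by linarith) (le_max_right _ _)
  obtain ⟨t, ht, hFt⟩ := intermediate_value_Icc (by linarith [hc i] : (0:ℝ) ≤ P + 1 / lam i)
    hF.continuousOn (show P ∈ Set.Icc (F 0) (F (P + 1 / lam i)) from ⟨by linarith, h1⟩)
  have htpos : 0 < t := by
    rcases ht.1.lt_or_eq with h | h
    · exact h
    · rw [← h, h0] at hFt
      linarith
  refine ⟨1 / t, ⟨one_div_pos.mpr htpos, by rw [one_div_one_div]; exact hFt⟩, ?_⟩
  rintro m ⟨_, hm⟩
  have key : 1 / m = t := by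
    rcases lt_trichotomy (1 / m) t with h | h | h
    · have := water_strict (fun s => 1 / lam s) _ _ h (by rw [hm]; exact hP)
      simp only [F] at hFt
      linarith
    · exact h
    · simp only [F] at hFt
      have := water_strict (fun s => 1 / lam s) _ _ h (by rw [hFt]; exact hP)
      linarith
  rw [← key, one_div_one_div]
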